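/- Let G be a strongly regular graph with parameters (1911, 270, 105, 27) containing an induced quadrangle x ~ u ~ y ~ v ~ x, and let U = {u, v, w₁, w₂} be a 4-element independent set whose elements are all adjacent to x. For vertices a, b let c(a,b) = |N(x) ∩ N(a) ∩ N(b)|. Then c(u,v) ∈ {24, 25} and the sum of c(a,b) over the six unordered pairs {a,b} ⊆ U satisfies 154 ≤ Σ c(a,b) ≤ 155. -/

import Mathlib

/-- `c(a,b) = |N(x) ∩ N(a) ∩ N(b)|`, the number of common neighbours of `x`, `a` and `b`. -/
def commonNbrCount {V : Type*} [Fintype V] [DecidableEq V] (G : SimpleGraph V)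
    [DecidableRel G.Adj] (x a b : V) : ℕ :=
  (G.neighborFinset x ∩ G.neighborFinset a ∩ G.neighborFinset b).card

/-- The Bonferroni lower bound for the cardinality of a union of four finite sets. -/
theorem Finset.card_add_card_add_card_add_card_le {α : Type*} [DecidableEq α]
    (A B C D : Finset α) :
    A.card + B.card + C.card + D.card ≤ (A ∪ B ∪ C ∪ D).card + ((A ∩ B).card + (A ∩ C).card +
      (A ∩ D).card + (B ∩ C).card + (B ∩ D).card + (C ∩ D).card) := by
  have hAB := Finset.card_union_add_card_inter A B
  have hABC := Finset.card_union_add_card_inter (A ∪ B) C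
  have hABCD := Finset.card_union_add_card_inter (A ∪ B ∪ C) D
  have hC : ((A ∪ B) ∩ C).card ≤ (A ∩ C).card + (B ∩ C).card := by
    rw [Finset.union_inter_distrib_right]
    exact Finset.card_union_le _ _
  have hD : ((A ∪ B ∪ C) ∩ D).card ≤ (A ∩ D).card + (B ∩ D).card + (C ∩ D).card := by
    rw [Finset.union_inter_distrib_right, Finset.union_inter_distrib_right]
    exact (Finset.card_union_le _ _).trans (Nat.add_le_add_right (Finset.card_union_le _ _) _)
  omega

section CommonNbrCount

variable {V : Type*} [Fintype V] [DecidableEq V] {G : SimpleGraph V} [DecidableRel G.Adj]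
  {n k l m : ℕ}

namespace SimpleGraph.IsSRGWith

theorem card_inter_neighborFinset_of_adj (h : G.IsSRGWith n k l m) {a b : V} (hab : G.Adj a b) :
    (G.neighborFinset a ∩ G.neighborFinset b).card = l := by
  rw [← h.of_adj a b hab, ← Set.toFinset_card]
  congr 1
  ext z
  simp [SimpleGraph.mem_commonNeighbors]

theorem card_inter_neighborFinset_of_not_adj (h : G.IsSRGWith n k l m) {a b : V} (hne : a ≠ b)
    (hab : ¬ G.Adj a b) : (G.neighborFinset a ∩ G.neighborFinset b).card = m := by
  rw [← h.of_not_adj hne hab, ← Set.toFinset_card]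
  congr 1
  ext z
  simp [SimpleGraph.mem_commonNeighbors]

/-- Common neighbours of `a` and `b` outside `N(x)` lower the possible value of `c(a,b)`. -/
theorem card_add_commonNbrCount_le (h : G.IsSRGWith n k l m) {x a b : V} (hne : a ≠ b)
    (hab : ¬ G.Adj a b) (S : Finset V) (hSx : ∀ z ∈ S, ¬ G.Adj x z) (hSa : ∀ z ∈ S, G.Adj a z)
    (hSb : ∀ z ∈ S, G.Adj b z) : S.card + commonNbrCount G x a b ≤ m := by
  rw [← h.card_inter_neighborFinset_of_not_adj hne hab, commonNbrCount,
    ← Finset.card_union_of_disjoint]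
  · refine Finset.card_le_card fun z hz ↦ ?_
    simp only [Finset.mem_union, Finset.mem_inter, SimpleGraph.mem_neighborFinset] at hz ⊢
    rcases hz with hz | hz
    · exact ⟨hSa z hz, hSb z hz⟩
    · exact ⟨hz.1.2, hz.2⟩
  · refine Finset.disjoint_left.2 fun z hz hz' ↦ hSx z hz ?_
    simp only [Finset.mem_inter, SimpleGraph.mem_neighborFinset] at hz'
    exact hz'.1.1

theorem commonNbrCount_add_one_le (h : G.IsSRGWith n k l m) {x a b : V} (hne : a ≠ b)
    (hab : ¬ G.Adj a b) (hxa : G.Adj x a) (hxb : G.Adj x b) :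
    commonNbrCount G x a b + 1 ≤ m := by
  have := h.card_add_commonNbrCount_le (x := x) hne hab {x} (by simp) (by simpa using hxa.symm)
    (by simpa using hxb.symm)
  simpa [add_comm] using this

/-- Four pairwise non-adjacent neighbours of `x` have many common neighbours within `N(x)`. -/
theorem four_mul_add_four_le (h : G.IsSRGWith n k l m) {x a b c d : V} {U : Finset V}
    (hU : U = {a, b, c, d}) (hcard : U.card = 4) (hUx : ∀ w ∈ U, G.Adj x w)
    (hUind : ∀ a ∈ U, ∀ b ∈ U, a ≠ b → ¬ G.Adj a b) :
    4 * l + 4 ≤ k + (commonNbrCount G x a b + commonNbrCount G x a c + commonNbrCount G x a d +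
      commonNbrCount G x b c + commonNbrCount G x b d + commonNbrCount G x c d) := by
  have hinter (p q : V) : commonNbrCount G x p q = ((G.neighborFinset x ∩ G.neighborFinset p) ∩
      (G.neighborFinset x ∩ G.neighborFinset q)).card := by
    rw [commonNbrCount, Finset.inter_assoc, Finset.inter_inter_distrib_left]
  have hl {w : V} (hw : w ∈ U) := h.card_inter_neighborFinset_of_adj (hUx w hw)
  have ha := hl (w := a) (by simp [hU])
  have hb := hl (w := b) (by simp [hU])
  have hc := hl (w := c) (by simp [hU])
  have hd := hl (w := d) (by simp [hU])
  have hbonf := Finset.card_add_card_add_card_add_card_le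
    (G.neighborFinset x ∩ G.neighborFinset a) (G.neighborFinset x ∩ G.neighborFinset b)
    (G.neighborFinset x ∩ G.neighborFinset c) (G.neighborFinset x ∩ G.neighborFinset d)
  have hindep {w z : V} (hw : w ∈ U) (hz : z ∈ U) : ¬ G.Adj w z := by
    rcases eq_or_ne w z with rfl | hne
    · exact G.irrefl
    · exact hUind w hw z hz hne
  have hunion : ((G.neighborFinset x ∩ G.neighborFinset a) ∪
      (G.neighborFinset x ∩ G.neighborFinset b) ∪ (G.neighborFinset x ∩ G.neighborFinset c) ∪
      (G.neighborFinset x ∩ G.neighborFinset d)).card + U.card ≤ k := by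
    rw [← h.regular x, ← G.card_neighborFinset_eq_degree, ← Finset.card_union_of_disjoint]
    · refine Finset.card_le_card fun z hz ↦ ?_
      have := hUx z
      simp only [Finset.mem_union, Finset.mem_inter, SimpleGraph.mem_neighborFinset] at hz ⊢
      tauto
    · refine Finset.disjoint_left.2 fun z hz hzU ↦ ?_
      have h1 : ¬ G.Adj a z := hindep (by simp [hU]) hzU
      have h2 : ¬ G.Adj b z := hindep (by simp [hU]) hzU
      have h3 : ¬ G.Adj c z := hindep (by simp [hU]) hzU
      have h4 : ¬ G.Adj d z := hindep (by simp [hU]) hzU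
      simp only [Finset.mem_union, Finset.mem_inter, SimpleGraph.mem_neighborFinset] at hz
      tauto
  simp only [hinter]
  omega

end SimpleGraph.IsSRGWith

end CommonNbrCount

/-- Let `G` be a strongly regular graph with parameters `(1911, 270, 105, 27)` with an induced
quadrangle `x ~ u ~ y ~ v ~ x`, and let `U = {u, v, w₁, w₂}` be a 4-element independent set of
vertices all adjacent to `x`. Then `c(u,v) ∈ {24, 25}` and the sum of `c(a,b)` over the six
unordered pairs of `U` lies between `154` and `155`. -/
theorem srg_1911_indep_four_common_neighbours {V : Type*} [Fintype V] [DecidableEq V]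
    (G : SimpleGraph V) [DecidableRel G.Adj] (h : G.IsSRGWith 1911 270 105 27)
    (x u y v : V)
    (hd : x ≠ u ∧ x ≠ y ∧ x ≠ v ∧ u ≠ y ∧ u ≠ v ∧ y ≠ v)
    (hxu : G.Adj x u) (huy : G.Adj u y) (hyv : G.Adj y v) (hvx : G.Adj v x)
    (hxy : ¬ G.Adj x y) (huv : ¬ G.Adj u v)
    (w₁ w₂ : V) (U : Finset V) (hU : U = {u, v, w₁, w₂}) (hUcard : U.card = 4)
    (hUx : ∀ w ∈ U, G.Adj x w)
    (hUind : ∀ a ∈ U, ∀ b ∈ U, a ≠ b → ¬ G.Adj a b) :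
    (commonNbrCount G x u v = 24 ∨ commonNbrCount G x u v = 25) ∧
    154 ≤ commonNbrCount G x u v + commonNbrCount G x u w₁ + commonNbrCount G x u w₂ +
        commonNbrCount G x v w₁ + commonNbrCount G x v w₂ + commonNbrCount G x w₁ w₂ ∧
    commonNbrCount G x u v + commonNbrCount G x u w₁ + commonNbrCount G x u w₂ +
        commonNbrCount G x v w₁ + commonNbrCount G x v w₂ + commonNbrCount G x w₁ w₂ ≤ 155 := by
  have hlower := h.four_mul_add_four_le hU hUcard hUx hUind
  have huvle := h.card_add_commonNbrCount_le (x := x) hd.2.2.2.2.1 huv {x, y} (by simp [hxy])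
    (by simp [hxu.symm, huy]) (by simp [hvx, hyv.symm])
  rw [Finset.card_pair hd.2.1] at huvle
  have hne : u ≠ w₁ ∧ u ≠ w₂ ∧ v ≠ w₁ ∧ v ≠ w₂ ∧ w₁ ≠ w₂ := by
    refine ⟨?_, ?_, ?_, ?_, ?_⟩ <;> rintro rfl <;>
      [have h3 := Finset.card_le_three (a := u) (b := v) (c := w₂);
       have h3 := Finset.card_le_three (a := u) (b := v) (c := w₁);
       have h3 := Finset.card_le_three (a := u) (b := v) (c := w₂);
       have h3 := Finset.card_le_three (a := u) (b := v) (c := w₁);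
       have h3 := Finset.card_le_three (a := u) (b := v) (c := w₁)] <;>
      (refine absurd (hUcard.symm.le.trans ((Finset.card_le_card ?_).trans h3)) (by decide)
       rw [hU]
       intro z
       simp only [Finset.mem_insert, Finset.mem_singleton]
       tauto)
  have hle {a b : V} (ha : a ∈ U) (hb : b ∈ U) (hab : a ≠ b) :=
    h.commonNbrCount_add_one_le hab (hUind a ha b hb hab) (hUx a ha) (hUx b hb)
  have hu : u ∈ U := by simp [hU]
  have hv : v ∈ U := by simp [hU]
  have hw₁ : w₁ ∈ U := by simp [hU]
  have hw₂ : w₂ ∈ U := by simp [hU]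
  have huw₁ := hle hu hw₁ hne.1
  have huw₂ := hle hu hw₂ hne.2.1
  have hvw₁ := hle hv hw₁ hne.2.2.1
  have hvw₂ := hle hv hw₂ hne.2.2.2.1
  have hw₁w₂ := hle hw₁ hw₂ hne.2.2.2.2
  omega
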